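/- arXiv:2108.09787 — 3 statements merged into one kernel-verified Lean document; each statement's English description precedes it below -/
import Mathlib

section
/- Let M be a Malcev algebra over k, V a k-vector space, and let an extending datum (⊲,▷,ω,{·,·}) be given such that the unified product bracket on M⊕V is a Malcev algebra bracket. Then for all x,z ∈ M and v,q ∈ V: [x,z]▷{v,q} = [x⊲v,z]▷q − (z⊲(x▷v))▷q − {z▷(x▷v), q} + x▷((z⊲v)▷q) + x▷{z▷v, q} + [z⊲q,x]▷v − (x⊲(z▷q))▷v − {x▷(z▷q), v} + z▷((x⊲q)▷v) + z▷{x▷q, v}. -/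
def IsBilin (k : Type*) [Field k] {A B C : Type*}
    [AddCommGroup A] [Module k A] [AddCommGroup B] [Module k B]
    [AddCommGroup C] [Module k C] (f : A → B → C) : Prop :=
  (∀ (x y : A) (z : B), f (x + y) z = f x z + f y z) ∧
  (∀ (c : k) (x : A) (z : B), f (c • x) z = c • f x z) ∧
  (∀ (x : A) (y z : B), f x (y + z) = f x y + f x z) ∧
  (∀ (c : k) (x : A) (z : B), f x (c • z) = c • f x z)

def jacF {A : Type*} [AddCommGroup A] (br : A → A → A) (x y z : A) : A :=
  br (br x y) z + br (br y z) x + br (br z x) y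

def IsMalcevBracket (k : Type*) [Field k] {A : Type*} [AddCommGroup A] [Module k A]
    (br : A → A → A) : Prop :=
  IsBilin k br ∧ (∀ x y : A, br x y = - br y x) ∧
  (∀ x y z : A, jacF br x y (br x z) = br (jacF br x y z) x)

def ubr {M V : Type*} [AddCommGroup M] [AddCommGroup V]
    (bm : M → M → M) (tl : M → V → M) (tr : M → V → V)
    (om : V → V → M) (bv : V → V → V) :
    M × V → M × V → M × V :=
  fun p q =>
    (bm p.1 q.1 + tl p.1 q.2 - tl q.1 p.2 + om p.2 q.2,
     tr p.1 q.2 - tr q.1 p.2 + bv p.2 q.2)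

theorem IsBilin.map_zero_left {k A B C : Type*} [Field k]
    [AddCommGroup A] [Module k A] [AddCommGroup B] [Module k B] [AddCommGroup C] [Module k C]
    {f : A → B → C} (h : IsBilin k f) (b : B) : f 0 b = 0 := by
  simpa using h.2.1 0 0 b

theorem IsBilin.map_zero_right {k A B C : Type*} [Field k]
    [AddCommGroup A] [Module k A] [AddCommGroup B] [Module k B] [AddCommGroup C] [Module k C]
    {f : A → B → C} (h : IsBilin k f) (a : A) : f a 0 = 0 := by
  simpa using h.2.2.2 0 a 0

theorem IsBilin.map_neg_left {k A B C : Type*} [Field k]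
    [AddCommGroup A] [Module k A] [AddCommGroup B] [Module k B] [AddCommGroup C] [Module k C]
    {f : A → B → C} (h : IsBilin k f) (a : A) (b : B) : f (-a) b = -f a b := by
  simpa using h.2.1 (-1) a b

theorem IsBilin.map_neg_right {k A B C : Type*} [Field k]
    [AddCommGroup A] [Module k A] [AddCommGroup B] [Module k B] [AddCommGroup C] [Module k C]
    {f : A → B → C} (h : IsBilin k f) (a : A) (b : B) : f a (-b) = -f a b := by
  simpa using h.2.2.2 (-1) a b

/-- The Malcev identity, linearized in its repeated argument. -/
theorem IsMalcevBracket.linearized {k A : Type*} [Field k] [AddCommGroup A] [Module k A]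
    {br : A → A → A} (h : IsMalcevBracket k br) (x w y z : A) :
    jacF br x y (br w z) + jacF br w y (br x z) =
      br (jacF br x y z) w + br (jacF br w y z) x := by
  obtain ⟨⟨add_left, -, add_right, -⟩, -, malcev⟩ := h
  have hxw := malcev (x + w) y z
  have hx := malcev x y z
  have hw := malcev w y z
  simp only [jacF, add_left, add_right] at hxw hx hw ⊢
  linear_combination (norm := module) hxw - hx - hw

/-- Sagle's identity holds in every Malcev algebra over a field of characteristic not two. -/
theorem IsMalcevBracket.sagle {k A : Type*} [Field k] [AddCommGroup A] [Module k A]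
    (h2 : (2 : k) ≠ 0) {br : A → A → A} (h : IsMalcevBracket k br) (x y z w : A) :
    br (br x z) (br y w) =
      br (br (br x y) z) w + br (br (br y z) w) x +
        br (br (br z w) x) y + br (br (br w x) y) z := by
  have h₁ := h.linearized x y z w
  have h₂ := h.linearized x z w y
  have h₃ := h.linearized w x y z
  obtain ⟨bilin, anti, -⟩ := h
  have anti_inner (a b c : A) : br a (br b c) = -br (br b c) a := anti _ _
  apply smul_right_injective A h2
  simp only [jacF, bilin.1, anti y x, anti z x, anti w x, anti z y, anti w y, anti w z,
    bilin.map_neg_left, bilin.map_neg_right, anti_inner y, anti_inner z, anti_inner w,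
    anti (br y z) (br x w), anti (br y w) (br x z), anti (br z w) (br x y)] at h₁ h₂ h₃ ⊢
  linear_combination (norm := module) h₁ - h₂ + h₃

theorem stmt8 {k : Type*} [Field k] (h2 : (2 : k) ≠ 0) (h3 : (3 : k) ≠ 0) {M V : Type*} [AddCommGroup M] [Module k M] [AddCommGroup V] [Module k V]
    (bm : M → M → M) (hbm : IsMalcevBracket k bm)
    (tl : M → V → M) (htl : IsBilin k tl)
    (tr : M → V → V) (htr : IsBilin k tr)
    (om : V → V → M) (hom : IsBilin k om) (homa : ∀ u v : V, om u v = - om v u)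
    (bv : V → V → V) (hbv : IsBilin k bv) (hbva : ∀ u v : V, bv u v = - bv v u)
    (huni : IsMalcevBracket k (ubr bm tl tr om bv)) :
    ∀ (x z : M) (v q : V),
      tr (bm x z) (bv v q) =
      tr (bm (tl x v) z) q - tr (tl z (tr x v)) q - bv (tr z (tr x v)) q
      + tr x (tr (tl z v) q) + tr x (bv (tr z v) q)
      + tr (bm (tl z q) x) v - tr (tl x (tr z q)) v - bv (tr x (tr z q)) v
      + tr z (tr (tl x q) v) + tr z (bv (tr x q) v) := by
  intro x z v q
  have sagle := congrArg Prod.snd (huni.sagle h2 (x, 0) (0, v) (z, 0) (0, q))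
  simp only [ubr, Prod.snd_add, sub_eq_add_neg, htl.map_zero_left, htl.map_zero_right,
    htr.map_zero_left, htr.map_zero_right, hom.map_zero_left, hom.map_zero_right,
    hbv.map_zero_left, hbv.map_zero_right, hbm.1.map_zero_left, hbm.1.map_zero_right,
    htl.map_neg_left, htr.map_neg_left, htr.map_neg_right,
    hbv.map_neg_left, htr.1, htr.2.2.1, neg_zero, add_zero, zero_add, neg_add, neg_neg] at sagle ⊢
  linear_combination (norm := module) sagle
end

section
/- Let M be a Malcev algebra over k, V a k-vector space with an antisymmetric bilinear bracket {·,·} : V×V→V, and let ⊲ : M×V→M, ▷ : M×V→V be bilinear maps. Define on M⊕V the antisymmetric bracket [(x,u),(y,v)] = ([x,y] + x⊲v − y⊲u, x▷v − y▷u + {u,v}). Then M⊕V is a Malcev algebra (a matched pair) if and only if (V,{·,·}) is a Malcev algebra and the following hold. For all x,y,z ∈ M, q ∈ V: (a) [[x,z], y⊲q] + [x,z]⊲(y▷q) = [[x,y],z]⊲q + [[y,z]⊲q, x] − x⊲([y,z]▷q) + [[z⊲q,x],y] − [x⊲(z▷q),y] + y⊲(x▷(z▷q)) − [[x⊲q,y],z]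 + [y⊲(x▷q),z] − z⊲(y▷(x▷q)); (b) [x,z]▷(y▷q) = [[x,y],z]▷q − x▷([y,z]▷q) + y▷(x▷(z▷q)) − z▷(y▷(x▷q)). For all x,z ∈ M, v,q ∈ V: (c) [x,z]⊲{v,q} = [x⊲v,z]⊲q − (z⊲(x▷v))⊲q − [(z⊲v)⊲q, x] + x⊲((z⊲v)▷q) + x⊲{z▷v, q} + [z⊲q,x]⊲v − (x⊲(z▷q))⊲v − [(x⊲q)⊲v, z] + z⊲((x⊲q)▷v) + z⊲{x▷q, v}; (d) [x,z]▷{v,q} = [x⊲v,z]▷q − (z⊲(x▷v))▷q − {z▷(x▷v), q} + x▷((z⊲v)▷q) + x▷{z▷v, q} + [z⊲q,x]▷v − (x⊲(z▷q))▷v − {x▷(z▷q), v} + z▷((x⊲q)▷v) + z▷{x▷q, v}. For all x,y ∈ M, p,q ∈ V: (e) [x⊲p, y⊲q] + (x⊲p)⊲(y▷q) − (y⊲q)⊲(x▷p) = ([x,y]⊲p)⊲q + [(y⊲p)⊲q, x] − x⊲((y⊲p)▷q) − x⊲{y▷p, q} − [x⊲{p,q}, y] + y⊲(x▷{p,q})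 − [x⊲q,y]⊲p + (y⊲(x▷q))⊲p; (f) {x▷p, y▷q} + (x⊲p)▷(y▷q) − (y⊲q)▷(x▷p) = {[x,y]▷p, q} + ([x,y]⊲p)▷q − x▷{y▷p, q} − x▷((y⊲p)▷q) + y▷(x▷{p,q}) + {y▷(x▷q), p} − [x⊲q,y]▷p + (y⊲(x▷q))▷p. For all x ∈ M, p,v,q ∈ V: (g) (x⊲v)⊲{p,q} = ((x⊲p)⊲v)⊲q − x⊲{{p,v},q} − (x⊲{v,q})⊲p − ((x⊲q)⊲p)⊲v; (h) (x⊲v)▷{p,q} + {x▷v, {p,q}} = ((x⊲p)⊲v)▷q + {(x⊲p)▷v, q} + {{x▷p, v}, q} − x▷{{p,v}, q} − (x⊲{v,q})▷p − {x▷{v,q}, p} − ((x⊲q)⊲p)▷v − {(x⊲q)▷p, v} − {{x▷q, p}, v}. -/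
namespace IsBilin

variable {k : Type*} [Field k] {A B C : Type*}
  [AddCommGroup A] [Module k A] [AddCommGroup B] [Module k B]
  [AddCommGroup C] [Module k C] {f : A → B → C}

theorem add_left (hf : IsBilin k f) (x y : A) (z : B) : f (x + y) z = f x z + f y z :=
  hf.1 x y z

theorem add_right (hf : IsBilin k f) (x : A) (y z : B) : f x (y + z) = f x y + f x z :=
  hf.2.2.1 x y z

theorem zero_left (hf : IsBilin k f) (z : B) : f 0 z = 0 := by
  simpa using hf.2.1 0 0 z

theorem zero_right (hf : IsBilin k f) (x : A) : f x 0 = 0 := by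
  simpa using hf.2.2.2 0 x 0

theorem neg_left (hf : IsBilin k f) (x : A) (z : B) : f (-x) z = -f x z := by
  simpa using hf.2.1 (-1) x z

theorem neg_right (hf : IsBilin k f) (x : A) (z : B) : f x (-z) = -f x z := by
  simpa using hf.2.2.2 (-1) x z

theorem sub_left (hf : IsBilin k f) (x y : A) (z : B) : f (x - y) z = f x z - f y z := by
  rw [sub_eq_add_neg, hf.add_left, hf.neg_left, sub_eq_add_neg]

end IsBilin

/-- The difference of the two sides of Sagle's identity
`[[x,z],[y,t]] = [[[x,y],z],t] + [[[y,z],t],x] + [[[z,t],x],y] + [[[t,x],y],z]`. -/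
def sagle {A : Type*} [AddCommGroup A] (br : A → A → A) (x y z t : A) : A :=
  br (br x z) (br y t) - (br (br (br x y) z) t + br (br (br y z) t) x
    + br (br (br z t) x) y + br (br (br t x) y) z)

section Sagle

variable {k : Type*} [Field k] {A : Type*} [AddCommGroup A] [Module k A] {br : A → A → A}

theorem sagle_rotate (hb : IsBilin k br) (ha : ∀ x y, br x y = -br y x) (x y z t : A) :
    sagle br y z t x = sagle br x y z t := by
  simp only [sagle, ha z x, ha (br y t), hb.neg_left, neg_neg]
  abel

theorem sagle_add (hb : IsBilin k br) (x x' y z t : A) :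
    sagle br (x + x') y z t = sagle br x y z t + sagle br x' y z t := by
  simp only [sagle, hb.add_left, hb.add_right]
  abel

/-- Since `sagle` is additive and cyclically invariant, it vanishes as soon as it vanishes on
one representative of each cyclic word in two subsets that span additively. -/
theorem sagle_eq_zero_of_cyclic_words (hb : IsBilin k br) (ha : ∀ x y, br x y = -br y x)
    {M V : Type*} {i : M → A} {j : V → A} (hij : ∀ a, ∃ m v, a = i m + j v)
    (hmmmm : ∀ x y z t, sagle br (i x) (i y) (i z) (i t) = 0)
    (hmmmv : ∀ x y z t, sagle br (i x) (i y) (i z) (j t) = 0)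
    (hmmvv : ∀ x y z t, sagle br (i x) (i y) (j z) (j t) = 0)
    (hmvmv : ∀ x y z t, sagle br (i x) (j y) (i z) (j t) = 0)
    (hmvvv : ∀ x y z t, sagle br (i x) (j y) (j z) (j t) = 0)
    (hvvvv : ∀ x y z t, sagle br (j x) (j y) (j z) (j t) = 0) (x y z t : A) :
    sagle br x y z t = 0 := by
  have rot := sagle_rotate hb ha
  have split (y z t : A) (hi : ∀ m, sagle br (i m) y z t = 0)
      (hj : ∀ v, sagle br (j v) y z t = 0) (x : A) : sagle br x y z t = 0 := by
    obtain ⟨m, v, rfl⟩ := hij x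
    rw [sagle_add hb, hi m, hj v, add_zero]
  apply split <;> intro x <;> rw [← rot] <;>
  apply split <;> intro y <;> rw [← rot] <;>
  apply split <;> intro z <;> rw [← rot] <;>
  apply split <;> intro t <;>
  first
    | simp only [hmmmm, hmmmv, hmmvv, hmvmv, hmvvv, hvvvv]
    | (rw [← rot]; simp only [hmmmv, hmmvv, hmvmv, hmvvv])
    | (rw [← rot, ← rot]; simp only [hmmmv, hmmvv, hmvvv])
    | (rw [← rot, ← rot, ← rot]; simp only [hmmmv, hmmvv, hmvvv])

theorem self_eq_zero_of_antisymm (h2 : (2 : k) ≠ 0) (ha : ∀ x y, br x y = -br y x) (x : A) :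
    br x x = 0 := by
  have h : (2 : k) • br x x = 0 := by
    rw [two_smul]
    nth_rewrite 1 [ha x x]
    exact neg_add_cancel _
  exact (smul_eq_zero.mp h).resolve_left h2

theorem malcev_eq_of_sagle (hb : IsBilin k br) (h2 : (2 : k) ≠ 0)
    (ha : ∀ x y, br x y = -br y x) {x y z : A} (hs : sagle br x y z x = 0) :
    jacF br x y (br x z) = br (jacF br x y z) x := by
  have h : br (br x y) (br x z) = br (br (br x y) z) x + br (br (br y z) x) x
      + br (br (br z x) x) y := by
    rw [sagle, self_eq_zero_of_antisymm h2 ha x, hb.zero_left, hb.zero_left, add_zero,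
      sub_eq_zero, ha y x, hb.neg_right, ha (br x z), neg_neg] at hs
    exact hs
  simp only [jacF, hb.add_left, ha y (br x z), ha z x, hb.neg_left] at h ⊢
  linear_combination (norm := abel1) h

theorem malcev_polarized (hb : IsBilin k br)
    (hm : ∀ x y z : A, jacF br x y (br x z) = br (jacF br x y z) x) (x w y z : A) :
    jacF br x y (br w z) + jacF br w y (br x z) =
      br (jacF br x y z) w + br (jacF br w y z) x := by
  have h := hm (x + w) y z
  have hx := hm x y z
  have hw := hm w y z
  simp only [jacF, hb.add_left, hb.add_right] at h hx hw ⊢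
  linear_combination (norm := abel1) h - hx - hw

theorem sagle_eq_zero_of_malcev (hb : IsBilin k br) (h2 : (2 : k) ≠ 0)
    (ha : ∀ x y, br x y = -br y x)
    (hm : ∀ x y z : A, jacF br x y (br x z) = br (jacF br x y z) x) (x y z t : A) :
    sagle br x y z t = 0 := by
  have h : (2 : k) • sagle br x y z t = 0 := by
    have e₁ := malcev_polarized hb hm x y z t
    have e₂ := malcev_polarized hb hm x z t y
    have e₃ := malcev_polarized hb hm x t y z
    rw [two_smul]
    simp only [sagle, jacF, hb.add_left, ha y x, ha z x, ha t x, ha z y, ha t y, ha t z,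
      hb.neg_left, hb.neg_right, fun u v => ha y (br u v),
      fun u v => ha z (br u v), fun u v => ha t (br u v), ha (br z t) (br x y),
      ha (br y t) (br x z), ha (br y z) (br x t)] at e₁ e₂ e₃ ⊢
    linear_combination (norm := abel1) e₁ - e₂ + e₃
  exact (smul_eq_zero.mp h).resolve_left h2

theorem isMalcevBracket_iff_sagle (hb : IsBilin k br) (h2 : (2 : k) ≠ 0)
    (ha : ∀ x y, br x y = -br y x) :
    IsMalcevBracket k br ↔ ∀ x y z t, sagle br x y z t = 0 :=
  ⟨fun h => sagle_eq_zero_of_malcev hb h2 ha h.2.2,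
    fun h => ⟨hb, ha, fun x y z => malcev_eq_of_sagle hb h2 ha (h x y z x)⟩⟩

end Sagle

section MatchedPair

variable {k : Type*} [Field k] {M V : Type*} [AddCommGroup M] [Module k M]
  [AddCommGroup V] [Module k V] {bm : M → M → M} {tl : M → V → M} {tr : M → V → V}
  {bv : V → V → V}

theorem isBilin_matchedPair (hbm : IsBilin k bm) (htl : IsBilin k tl) (htr : IsBilin k tr)
    (hbv : IsBilin k bv) :
    IsBilin k (fun p q : M × V =>
      (bm p.1 q.1 + tl p.1 q.2 - tl q.1 p.2, tr p.1 q.2 - tr q.1 p.2 + bv p.2 q.2)) := by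
  refine ⟨fun x y z => ?_, fun c x z => ?_, fun x y z => ?_, fun c x z => ?_⟩
  · ext <;> simp only [Prod.fst_add, Prod.snd_add, hbm.add_left, htl.add_left, htl.add_right,
      htr.add_left, htr.add_right, hbv.add_left] <;> abel
  · ext <;> simp only [Prod.smul_fst, Prod.smul_snd, hbm.2.1, htl.2.1, htl.2.2.2, htr.2.1,
      htr.2.2.2, hbv.2.1, smul_add, smul_sub]
  · ext <;> simp only [Prod.fst_add, Prod.snd_add, hbm.add_right, htl.add_left, htl.add_right,
      htr.add_left, htr.add_right, hbv.add_right] <;> abel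
  · ext <;> simp only [Prod.smul_fst, Prod.smul_snd, hbm.2.2.2, htl.2.1, htl.2.2.2, htr.2.1,
      htr.2.2.2, hbv.2.2.2, smul_add, smul_sub]

theorem antisymm_matchedPair (hbma : ∀ x y : M, bm x y = -bm y x)
    (hbva : ∀ u v : V, bv u v = -bv v u) (p q : M × V) :
    ((bm p.1 q.1 + tl p.1 q.2 - tl q.1 p.2, tr p.1 q.2 - tr q.1 p.2 + bv p.2 q.2) : M × V) =
      -(bm q.1 p.1 + tl q.1 p.2 - tl p.1 q.2, tr q.1 p.2 - tr p.1 q.2 + bv q.2 p.2) := by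
  ext
  · simp only [Prod.fst_neg, hbma p.1 q.1]
    abel
  · simp only [Prod.snd_neg, hbva p.2 q.2]
    abel

end MatchedPair

theorem stmt12 {k : Type*} [Field k] (h2 : (2 : k) ≠ 0) (h3 : (3 : k) ≠ 0) {M V : Type*} [AddCommGroup M] [Module k M] [AddCommGroup V] [Module k V]
    (bm : M → M → M) (hbm : IsMalcevBracket k bm)
    (tl : M → V → M) (htl : IsBilin k tl)
    (tr : M → V → V) (htr : IsBilin k tr)
    (bv : V → V → V) (hbv : IsBilin k bv) (hbva : ∀ u v : V, bv u v = - bv v u) :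
    IsMalcevBracket k
      (fun p q : M × V =>
        (bm p.1 q.1 + tl p.1 q.2 - tl q.1 p.2, tr p.1 q.2 - tr q.1 p.2 + bv p.2 q.2)) ↔
    (IsMalcevBracket k bv ∧
    (∀ (x y z : M) (q : V),
      bm (bm x z) (tl y q) + tl (bm x z) (tr y q) =
      tl (bm (bm x y) z) q + bm (tl (bm y z) q) x - tl x (tr (bm y z) q)
      + bm (bm (tl z q) x) y - bm (tl x (tr z q)) y + tl y (tr x (tr z q))
      - bm (bm (tl x q) y) z + bm (tl y (tr x q)) z - tl z (tr y (tr x q))) ∧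
    (∀ (x y z : M) (q : V),
      tr (bm x z) (tr y q) =
      tr (bm (bm x y) z) q - tr x (tr (bm y z) q)
      + tr y (tr x (tr z q)) - tr z (tr y (tr x q))) ∧
    (∀ (x z : M) (v q : V),
      tl (bm x z) (bv v q) =
      tl (bm (tl x v) z) q - tl (tl z (tr x v)) q - bm (tl (tl z v) q) x
      + tl x (tr (tl z v) q) + tl x (bv (tr z v) q)
      + tl (bm (tl z q) x) v - tl (tl x (tr z q)) v - bm (tl (tl x q) v) z
      + tl z (tr (tl x q) v) + tl z (bv (tr x q) v)) ∧
    (∀ (x z : M) (v q : V),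
      tr (bm x z) (bv v q) =
      tr (bm (tl x v) z) q - tr (tl z (tr x v)) q - bv (tr z (tr x v)) q
      + tr x (tr (tl z v) q) + tr x (bv (tr z v) q)
      + tr (bm (tl z q) x) v - tr (tl x (tr z q)) v - bv (tr x (tr z q)) v
      + tr z (tr (tl x q) v) + tr z (bv (tr x q) v)) ∧
    (∀ (x y : M) (p q : V),
      bm (tl x p) (tl y q) + tl (tl x p) (tr y q) - tl (tl y q) (tr x p) =
      tl (tl (bm x y) p) q + bm (tl (tl y p) q) x - tl x (tr (tl y p) q) - tl x (bv (tr y p) q)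
      - bm (tl x (bv p q)) y + tl y (tr x (bv p q)) - tl (bm (tl x q) y) p + tl (tl y (tr x q)) p) ∧
    (∀ (x y : M) (p q : V),
      bv (tr x p) (tr y q) + tr (tl x p) (tr y q) - tr (tl y q) (tr x p) =
      bv (tr (bm x y) p) q + tr (tl (bm x y) p) q - tr x (bv (tr y p) q) - tr x (tr (tl y p) q)
      + tr y (tr x (bv p q)) + bv (tr y (tr x q)) p - tr (bm (tl x q) y) p + tr (tl y (tr x q)) p) ∧
    (∀ (x : M) (p v q : V),
      tl (tl x v) (bv p q) =
      tl (tl (tl x p) v) q - tl x (bv (bv p v) q) - tl (tl x (bv v q)) p - tl (tl (tl x q) p) v) ∧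
    (∀ (x : M) (p v q : V),
      tr (tl x v) (bv p q) + bv (tr x v) (bv p q) =
      tr (tl (tl x p) v) q + bv (tr (tl x p) v) q + bv (bv (tr x p) v) q
      - tr x (bv (bv p v) q)
      - tr (tl x (bv v q)) p - bv (tr x (bv v q)) p
      - tr (tl (tl x q) p) v - bv (tr (tl x q) p) v - bv (bv (tr x q) p) v)) := by
  obtain ⟨hm, hma, hmm⟩ := hbm
  have hms := sagle_eq_zero_of_malcev hm h2 hma hmm
  have hb := isBilin_matchedPair hm htl htr hbv
  have ha := antisymm_matchedPair (tl := tl) (tr := tr) hma hbva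
  rw [isMalcevBracket_iff_sagle hb h2 ha, isMalcevBracket_iff_sagle hbv h2 hbva]
  constructor
  · intro h
    refine ⟨fun u v w s => ?_, fun x y z q => ?_, fun x y z q => ?_, fun x z v q => ?_,
      fun x z v q => ?_, fun x y p q => ?_, fun x y p q => ?_, fun x p v q => ?_,
      fun x p v q => ?_⟩
    on_goal 1 => have e := congrArg Prod.snd (h (0, u) (0, v) (0, w) (0, s))
    on_goal 2 => have e := congrArg Prod.fst (h (x, 0) (y, 0) (z, 0) (0, q))
    on_goal 3 => have e := congrArg Prod.snd (h (x, 0) (y, 0) (z, 0) (0, q))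
    on_goal 4 => have e := congrArg Prod.fst (h (x, 0) (0, v) (z, 0) (0, q))
    on_goal 5 => have e := congrArg Prod.snd (h (x, 0) (0, v) (z, 0) (0, q))
    on_goal 6 => have e := congrArg Prod.fst (h (x, 0) (y, 0) (0, p) (0, q))
    on_goal 7 => have e := congrArg Prod.snd (h (x, 0) (y, 0) (0, p) (0, q))
    on_goal 8 => have e := congrArg Prod.fst (h (x, 0) (0, p) (0, v) (0, q))
    on_goal 9 => have e := congrArg Prod.snd (h (x, 0) (0, p) (0, v) (0, q))
    all_goals
      simp only [sagle, Prod.fst_zero, Prod.snd_zero, Prod.fst_sub, Prod.snd_sub, Prod.fst_add,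
        Prod.snd_add, hm.zero_left, hm.zero_right, htl.zero_left, htl.zero_right, htr.zero_left,
        htr.zero_right, hbv.zero_left, hbv.zero_right, hm.neg_left, htl.neg_left, htl.neg_right,
        htr.neg_left, htr.neg_right, hbv.neg_left, htl.add_right, htr.add_right, hbv.add_left,
        hm.sub_left, htl.sub_left, htr.sub_left, add_zero, zero_add, sub_zero, zero_sub, neg_neg]
        at e ⊢
      linear_combination (norm := abel1) e
  · rintro ⟨hv, hmmmv₁, hmmmv₂, hmvmv₁, hmvmv₂, hmmvv₁, hmmvv₂, hmvvv₁, hmvvv₂⟩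
    simp only [sagle] at hms hv
    refine sagle_eq_zero_of_cyclic_words hb ha (i := fun x : M => (x, 0))
      (j := fun v : V => (0, v)) (fun a => ⟨a.1, a.2, by simp⟩) (fun x y z t => ?_)
      (fun x y z q => ?_) (fun x y p q => ?_) (fun x v z q => ?_) (fun x p v q => ?_)
      (fun u v w s => ?_)
    on_goal 1 => have e : _ ∧ (0 : V) = 0 := ⟨hms x y z t, rfl⟩
    on_goal 2 => have e := And.intro (hmmmv₁ x y z q) (hmmmv₂ x y z q)
    on_goal 3 => have e := And.intro (hmmvv₁ x y p q) (hmmvv₂ x y p q)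
    on_goal 4 => have e := And.intro (hmvmv₁ x z v q) (hmvmv₂ x z v q)
    on_goal 5 => have e := And.intro (hmvvv₁ x p v q) (hmvvv₂ x p v q)
    on_goal 6 => have e : (0 : M) = 0 ∧ _ := ⟨rfl, hv u v w s⟩
    all_goals
      obtain ⟨e₁, e₂⟩ := e
      ext <;> simp only [sagle, Prod.fst_zero, Prod.snd_zero, Prod.fst_sub, Prod.snd_sub,
        Prod.fst_add, Prod.snd_add, hm.zero_left, hm.zero_right, htl.zero_left, htl.zero_right,
        htr.zero_left, htr.zero_right, hbv.zero_left, hbv.zero_right, hm.neg_left, htl.neg_left,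
        htl.neg_right, htr.neg_left, htr.neg_right, hbv.neg_left, htl.add_right, htr.add_right,
        hbv.add_left, hm.sub_left, htl.sub_left, htr.sub_left, add_zero, zero_add, sub_zero,
        zero_sub, neg_neg] <;>
        first | linear_combination (norm := abel1) e₁ | linear_combination (norm := abel1) e₂
end

section
/- Let M be a Malcev algebra over k, V a k-vector space with an antisymmetric bilinear bracket {·,·} : V×V→V, ⊲ : M×V→M a bilinear map, and ω : V×V→M an antisymmetric bilinear map. Define on M⊕V the antisymmetric bracket [(x,u),(y,v)] = ([x,y] + x⊲v − y⊲u + ω(u,v), {u,v}). Then M⊕V is a Malcev algebra (a crossed product) if and only if (V,{·,·}) is a Malcev algebra and the following hold. For all x,y,z ∈ M, q ∈ V: (a) [[x,z], y⊲q] = [[x,y],z]⊲q + [[y,z]⊲q, x] + [[z⊲q,x],y] − [[x⊲q,y],z]. For all x,y ∈ M, p,q ∈ V: (b) [x⊲p, y⊲q] = ([x,y]⊲p)⊲q + [(y⊲p)⊲q, x] + [[ω(p,q),x],y] − [x⊲{p,q}, y] − [x⊲q,y]⊲p. For all x,z ∈ M, v,q ∈ V: (c) [[x,z], ω(v,q)]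 + [x,z]⊲{v,q} = [x⊲v,z]⊲q − [(z⊲v)⊲q, x] + [z⊲q,x]⊲v − [(x⊲q)⊲v, z]. For all x ∈ M, p,v,q ∈ V: (d) [x⊲v, ω(p,q)] + (x⊲v)⊲{p,q} = ((x⊲p)⊲v)⊲q + [ω(p,v)⊲q, x] + [ω({p,v},q), x] − x⊲{{p,v},q} + [ω(v,q), x]⊲p − (x⊲{v,q})⊲p − ((x⊲q)⊲p)⊲v. For all u,p,v,q ∈ V: (e) [ω(u,p), ω(v,q)] + ω(u,p)⊲{v,q} − ω(v,q)⊲{u,p} + ω({u,p},{v,q}) = (ω(u,v)⊲p)⊲q + ω({u,v},p)⊲q + ω({{u,v},p}, q) + (ω(v,p)⊲q)⊲u + ω({v,p},q)⊲u + ω({{v,p},q}, u) + (ω(p,q)⊲u)⊲v + ω({p,q},u)⊲v + ω({{p,q},u}, v) + (ω(q,u)⊲v)⊲p + ω({q,u},v)⊲p + ω({{q,u},v}, p). -/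
section Bilin

variable {k : Type*} [Field k] {A B C : Type*} [AddCommGroup A] [Module k A]
  [AddCommGroup B] [Module k B] [AddCommGroup C] [Module k C] {f : A → B → C}

theorem IsBilin.zero_left_s13 (h : IsBilin k f) (z : B) : f 0 z = 0 := by
  simpa using h.2.1 0 0 z

theorem IsBilin.zero_right_s13 (h : IsBilin k f) (x : A) : f x 0 = 0 := by
  simpa using h.2.2.2 0 x 0

theorem IsBilin.neg_left_s13 (h : IsBilin k f) (x : A) (z : B) : f (-x) z = -f x z := by
  simpa using h.2.1 (-1) x z

theorem IsBilin.neg_right_s13 (h : IsBilin k f) (x : A) (z : B) : f x (-z) = -f x z := by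
  simpa using h.2.2.2 (-1) x z

end Bilin

/-- The defect of the Sagle identity, as a function of four variables. -/
def sagleDefect {A : Type*} [AddCommGroup A] (br : A → A → A) (x y z t : A) : A :=
  br (br (br x y) z) t + br (br (br y z) t) x + br (br (br z t) x) y + br (br (br t x) y) z
    - br (br x z) (br y t)

section Sagle

variable {k : Type*} [Field k] {A : Type*} [AddCommGroup A] [Module k A] {br : A → A → A}

theorem sagleDefect_add_left (h : IsBilin k br) (x x' y z t : A) :
    sagleDefect br (x + x') y z t = sagleDefect br x y z t + sagleDefect br x' y z t := by
  simp only [sagleDefect, h.1, h.2.2.1]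
  abel

theorem sagleDefect_rotate (h : IsBilin k br) (ha : ∀ x y, br x y = -br y x) (x y z t : A) :
    sagleDefect br y z t x = sagleDefect br x y z t := by
  simp only [sagleDefect]
  rw [ha (br y t), ha z x, h.neg_left_s13]
  abel

theorem eq_zero_of_eq_neg (h2 : (2 : k) ≠ 0) {a : A} (h : a = -a) : a = 0 := by
  have h' : (2 : k) • a = 0 := by
    rw [two_smul]
    exact add_eq_zero_iff_eq_neg.mpr h
  exact (smul_eq_zero.mp h').resolve_left h2

theorem sagleDefect_self (h2 : (2 : k) ≠ 0) (h : IsBilin k br) (ha : ∀ x y, br x y = -br y x)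
    (x y z : A) :
    sagleDefect br x x y z = br (jacF br x y z) x - jacF br x y (br x z) := by
  have hxx : br x x = 0 := eq_zero_of_eq_neg h2 (ha x x)
  simp only [sagleDefect, jacF, h.1, hxx, h.zero_left_s13]
  rw [ha y (br x z), ha z x]
  simp only [h.neg_left_s13]
  abel

/-- In characteristic different from two, the Malcev identity is equivalent to the Sagle
identity. -/
theorem isMalcevBracket_iff_sagleDefect (h2 : (2 : k) ≠ 0) (h : IsBilin k br)
    (ha : ∀ x y, br x y = -br y x) :
    IsMalcevBracket k br ↔ ∀ x y z t, sagleDefect br x y z t = 0 := by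
  constructor
  · rintro ⟨-, -, hm⟩
    have hself (x y z : A) : sagleDefect br x x y z = 0 := by
      rw [sagleDefect_self h2 h ha, hm, sub_self]
    have hrot := sagleDefect_rotate h ha
    have hadd := sagleDefect_add_left h
    have hadd' (x y y' z t : A) :
        sagleDefect br x (y + y') z t = sagleDefect br x y z t + sagleDefect br x y' z t := by
      rw [← hrot, hadd, hrot x, hrot x]
    have hswap (x y z t : A) : sagleDefect br x y z t = -sagleDefect br y x z t := by
      have := hself (x + y) z t
      rw [hadd, hadd', hadd', hself, hself, zero_add, add_zero] at this
      exact eq_neg_of_add_eq_zero_left this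
    -- A four-cycle is an odd permutation, so the defect equals its own negative.
    intro x y z t
    apply eq_zero_of_eq_neg h2
    calc sagleDefect br x y z t = -sagleDefect br y x z t := hswap ..
      _ = -sagleDefect br x z t y := by rw [hrot y]
      _ = sagleDefect br z x t y := by rw [hswap, neg_neg]
      _ = sagleDefect br x t y z := by rw [hrot z]
      _ = -sagleDefect br t x y z := hswap ..
      _ = -sagleDefect br x y z t := by rw [hrot t]
  · intro hs
    refine ⟨h, ha, fun x y z => ?_⟩
    have := hs x x y z
    rw [sagleDefect_self h2 h ha] at this
    exact (sub_eq_zero.mp this).symm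

end Sagle

theorem stmt13 {k : Type*} [Field k] (h2 : (2 : k) ≠ 0) (h3 : (3 : k) ≠ 0) {M V : Type*} [AddCommGroup M] [Module k M] [AddCommGroup V] [Module k V]
    (bm : M → M → M) (hbm : IsMalcevBracket k bm)
    (tl : M → V → M) (htl : IsBilin k tl)
    (om : V → V → M) (hom : IsBilin k om) (homa : ∀ u v : V, om u v = - om v u)
    (bv : V → V → V) (hbv : IsBilin k bv) (hbva : ∀ u v : V, bv u v = - bv v u) :
    IsMalcevBracket k
      (fun p q : M × V =>
        (bm p.1 q.1 + tl p.1 q.2 - tl q.1 p.2 + om p.2 q.2, bv p.2 q.2)) ↔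
    (IsMalcevBracket k bv ∧
    (∀ (x y z : M) (q : V),
      bm (bm x z) (tl y q) =
      tl (bm (bm x y) z) q + bm (tl (bm y z) q) x + bm (bm (tl z q) x) y - bm (bm (tl x q) y) z) ∧
    (∀ (x y : M) (p q : V),
      bm (tl x p) (tl y q) =
      tl (tl (bm x y) p) q + bm (tl (tl y p) q) x + bm (bm (om p q) x) y
      - bm (tl x (bv p q)) y - tl (bm (tl x q) y) p) ∧
    (∀ (x z : M) (v q : V),
      bm (bm x z) (om v q) + tl (bm x z) (bv v q) =
      tl (bm (tl x v) z) q - bm (tl (tl z v) q) x + tl (bm (tl z q) x) v - bm (tl (tl x q) v) z) ∧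
    (∀ (x : M) (p v q : V),
      bm (tl x v) (om p q) + tl (tl x v) (bv p q) =
      tl (tl (tl x p) v) q + bm (tl (om p v) q) x + bm (om (bv p v) q) x - tl x (bv (bv p v) q)
      + tl (bm (om v q) x) p - tl (tl x (bv v q)) p - tl (tl (tl x q) p) v) ∧
    (∀ (u p v q : V),
      bm (om u p) (om v q) + tl (om u p) (bv v q) - tl (om v q) (bv u p) + om (bv u p) (bv v q) =
      tl (tl (om u v) p) q + tl (om (bv u v) p) q + om (bv (bv u v) p) q
      + tl (tl (om v p) q) u + tl (om (bv v p) q) u + om (bv (bv v p) q) u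
      + tl (tl (om p q) u) v + tl (om (bv p q) u) v + om (bv (bv p q) u) v
      + tl (tl (om q u) v) p + tl (om (bv q u) v) p + om (bv (bv q u) v) p)) := by
  obtain ⟨hbm, hbma, hbmj⟩ := hbm
  have hsm := (isMalcevBracket_iff_sagleDefect h2 hbm hbma).mp ⟨hbm, hbma, hbmj⟩
  rw [isMalcevBracket_iff_sagleDefect h2 hbv hbva]
  set br : M × V → M × V → M × V := fun p q =>
    (bm p.1 q.1 + tl p.1 q.2 - tl q.1 p.2 + om p.2 q.2, bv p.2 q.2) with hbr
  have hb : IsBilin k br := by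
    refine ⟨fun x y z => ?_, fun c x z => ?_, fun x y z => ?_, fun c x z => ?_⟩ <;>
      simp only [hbr, Prod.ext_iff, Prod.fst_add, Prod.snd_add, Prod.smul_fst, Prod.smul_snd,
        hbm.1, htl.1, hom.1, hbv.1, hbm.2.1, htl.2.1, hom.2.1, hbv.2.1,
        hbm.2.2.1, htl.2.2.1, hom.2.2.1, hbv.2.2.1, hbm.2.2.2, htl.2.2.2, hom.2.2.2, hbv.2.2.2,
        and_true] <;> module
  have hba (x y : M × V) : br x y = -br y x := by
    simp only [hbr, Prod.ext_iff, Prod.fst_neg, Prod.snd_neg]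
    refine ⟨?_, hbva _ _⟩
    rw [hbma, homa]
    abel
  rw [isMalcevBracket_iff_sagleDefect h2 hb hba]
  have hadd := sagleDefect_add_left hb
  have hrot := sagleDefect_rotate hb hba
  have hMMMM (x y z t : M) : sagleDefect br (x, 0) (y, 0) (z, 0) (t, 0) =
      (sagleDefect bm x y z t, 0) := by
    simp [sagleDefect, hbr, sub_eq_add_neg, htl.zero_right_s13, hom.zero_left_s13, hbv.zero_left_s13]
  have hMMMV (x y z : M) (q : V) : sagleDefect br (x, 0) (y, 0) (z, 0) (0, q) =
      (tl (bm (bm x y) z) q + bm (tl (bm y z) q) x + bm (bm (tl z q) x) y - bm (bm (tl x q) y) z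
        - bm (bm x z) (tl y q), 0) := by
    simp [sagleDefect, hbr, sub_eq_add_neg, hbm.zero_left_s13, hbm.zero_right_s13, hbm.neg_left_s13,
      htl.zero_left_s13, htl.zero_right_s13, hom.zero_left_s13, hom.zero_right_s13, hbv.zero_left_s13,
      hbv.zero_right_s13]
  have hMMVV (x y : M) (p q : V) : sagleDefect br (x, 0) (y, 0) (0, p) (0, q) =
      (tl (tl (bm x y) p) q + bm (tl (tl y p) q) x + bm (bm (om p q) x) y
        - bm (tl x (bv p q)) y - tl (bm (tl x q) y) p - bm (tl x p) (tl y q), 0) := by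
    simp [Prod.ext_iff, sagleDefect, hbr, sub_eq_add_neg, hbm.1, hbm.zero_left_s13, hbm.zero_right_s13,
      hbm.neg_left_s13, htl.1, htl.zero_left_s13, htl.zero_right_s13, htl.neg_left_s13, hom.zero_left_s13,
      hom.zero_right_s13, hbv.zero_left_s13, hbv.zero_right_s13]
    abel
  have hMVMV (x z : M) (v q : V) : sagleDefect br (x, 0) (0, v) (z, 0) (0, q) =
      (tl (bm (tl x v) z) q - bm (tl (tl z v) q) x + tl (bm (tl z q) x) v - bm (tl (tl x q) v) z
        - (bm (bm x z) (om v q) + tl (bm x z) (bv v q)), 0) := by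
    simp [sagleDefect, hbr, sub_eq_add_neg, hbm.zero_left_s13, hbm.zero_right_s13, hbm.neg_left_s13,
      htl.zero_left_s13, htl.zero_right_s13, htl.neg_left_s13, hom.zero_left_s13, hom.zero_right_s13, hbv.zero_left_s13,
      hbv.zero_right_s13]
  have hMVVV (x : M) (p v q : V) : sagleDefect br (x, 0) (0, p) (0, v) (0, q) =
      (tl (tl (tl x p) v) q + bm (tl (om p v) q) x + bm (om (bv p v) q) x
        - tl x (bv (bv p v) q) + tl (bm (om v q) x) p - tl (tl x (bv v q)) p - tl (tl (tl x q) p) v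
        - (bm (tl x v) (om p q) + tl (tl x v) (bv p q)), 0) := by
    simp [Prod.ext_iff, sagleDefect, hbr, sub_eq_add_neg, hbm.1, hbm.zero_left_s13, hbm.zero_right_s13,
      htl.1, htl.zero_left_s13, htl.zero_right_s13, htl.neg_left_s13, hom.zero_left_s13, hom.zero_right_s13,
      hbv.zero_left_s13, hbv.zero_right_s13]
    abel
  have hVVVV (u p v q : V) : sagleDefect br (0, u) (0, v) (0, p) (0, q) =
      (tl (tl (om u v) p) q + tl (om (bv u v) p) q + om (bv (bv u v) p) q
        + tl (tl (om v p) q) u + tl (om (bv v p) q) u + om (bv (bv v p) q) u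
        + tl (tl (om p q) u) v + tl (om (bv p q) u) v + om (bv (bv p q) u) v
        + tl (tl (om q u) v) p + tl (om (bv q u) v) p + om (bv (bv q u) v) p
        - (bm (om u p) (om v q) + tl (om u p) (bv v q) - tl (om v q) (bv u p)
          + om (bv u p) (bv v q)), sagleDefect bv u v p q) := by
    simp [Prod.ext_iff, sagleDefect, hbr, sub_eq_add_neg, hbm.1, hbm.zero_left_s13, hbm.zero_right_s13,
      htl.1, htl.zero_left_s13]
    abel
  clear_value br
  constructor
  · intro hs
    refine ⟨fun u v p q => ?_, fun x y z q => ?_, fun x y p q => ?_, fun x z v q => ?_,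
      fun x p v q => ?_, fun u p v q => ?_⟩
    · simpa using congrArg Prod.snd ((hVVVV u p v q).symm.trans (hs _ _ _ _))
    · exact (sub_eq_zero.mp (congrArg Prod.fst ((hMMMV x y z q).symm.trans (hs _ _ _ _)))).symm
    · exact (sub_eq_zero.mp (congrArg Prod.fst ((hMMVV x y p q).symm.trans (hs _ _ _ _)))).symm
    · exact (sub_eq_zero.mp (congrArg Prod.fst ((hMVMV x z v q).symm.trans (hs _ _ _ _)))).symm
    · exact (sub_eq_zero.mp (congrArg Prod.fst ((hMVVV x p v q).symm.trans (hs _ _ _ _)))).symm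
    · exact (sub_eq_zero.mp (congrArg Prod.fst ((hVVVV u p v q).symm.trans (hs _ _ _ _)))).symm
  · rintro ⟨hV, hA, hB, hC, hD, hE⟩
    have hMMMM0 (x y z t : M) : sagleDefect br (x, 0) (y, 0) (z, 0) (t, 0) = 0 := by
      rw [hMMMM, hsm]; rfl
    have hMMMV0 (x y z : M) (q : V) : sagleDefect br (x, 0) (y, 0) (z, 0) (0, q) = 0 := by
      rw [hMMMV, hA, sub_self]; rfl
    have hMMVV0 (x y : M) (p q : V) : sagleDefect br (x, 0) (y, 0) (0, p) (0, q) = 0 := by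
      rw [hMMVV, hB, sub_self]; rfl
    have hMVMV0 (x z : M) (v q : V) : sagleDefect br (x, 0) (0, v) (z, 0) (0, q) = 0 := by
      rw [hMVMV, hC, sub_self]; rfl
    have hMVVV0 (x : M) (p v q : V) : sagleDefect br (x, 0) (0, p) (0, v) (0, q) = 0 := by
      rw [hMVVV, hD, sub_self]; rfl
    have hVVVV0 (u v p q : V) : sagleDefect br (0, u) (0, v) (0, p) (0, q) = 0 := by
      rw [hVVVV, hE, sub_self, hV]; rfl
    have hsplit (x y z t : M × V) (h₁ : sagleDefect br (x.1, 0) y z t = 0)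
        (h₂ : sagleDefect br (0, x.2) y z t = 0) : sagleDefect br y z t x = 0 := by
      have hx : x = (x.1, 0) + (0, x.2) := by simp
      rw [hrot, hx, hadd, h₁, h₂, add_zero]
    intro x y z t
    -- Split the four arguments one after the other into their `M` and `V` parts.
    apply hsplit <;> apply hsplit <;> apply hsplit <;> apply hsplit <;>
    first
    | simp only [hMMMM0, hMMMV0, hMMVV0, hMVMV0, hMVVV0, hVVVV0]
    | (rw [hrot]; simp only [hMMMV0, hMMVV0, hMVMV0, hMVVV0])
    | (rw [hrot, hrot]; simp only [hMMMV0, hMMVV0, hMVVV0])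
    | (rw [hrot, hrot, hrot]; simp only [hMMMV0, hMMVV0, hMVVV0])
end
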